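/- Let Φ be a non-uniform random 2-SAT formula on n variables with probability vector p satisfying p₁² = Θ(Σ_{i=1}^n pᵢ²) and p₂² = o(Σ_{i=2}^n pᵢ²). If m = Θ((C·p₁·(Σ_{i=2}^n pᵢ²)^{1/2})^{-1}), then Φ is unsatisfiable with probability at least some positive constant (independent of n). -/

import Mathlib

open Finset Filter Asymptotics

open scoped Classical

/-- The probability of drawing a given ordered 2-clause (an ordered pair of literals over
distinct variables); an unordered 2-clause over variables `i ≠ j` then has total probability
`(C/2)·pᵢ·pⱼ` where `C = (1 - ∑ pᵢ²)⁻¹`. -/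
noncomputable def clauseProb2 (n : ℕ) (p : ℕ → ℝ) (c : (Fin n × Bool) × (Fin n × Bool)) : ℝ :=
  if c.1.1 ≠ c.2.1 then
    (1 - ∑ i ∈ Finset.range n, p i ^ 2)⁻¹ / 4 * p c.1.1.1 * p c.2.1.1
  else 0

/-- The probability of drawing a given formula: `m` clauses drawn independently. -/
noncomputable def formulaProb2 (n m : ℕ) (p : ℕ → ℝ)
    (Φ : Fin m → (Fin n × Bool) × (Fin n × Bool)) : ℝ :=
  ∏ j, clauseProb2 n p (Φ j)

/-- Satisfiability of a 2-CNF formula: a literal `(x, b)` is satisfied by an assignment `a`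
iff `a x = b`. -/
def Sat2 {n m : ℕ} (Φ : Fin m → (Fin n × Bool) × (Fin n × Bool)) : Prop :=
  ∃ a : Fin n → Bool, ∀ j, a (Φ j).1.1 = (Φ j).1.2 ∨ a (Φ j).2.1 = (Φ j).2.2

/-- The probability that a non-uniform random 2-SAT formula with `n` variables, `m` clauses
and variable distribution `p` is satisfiable. -/
noncomputable def probSat2 (n m : ℕ) (p : ℕ → ℝ) : ℝ :=
  ∑ Φ : Fin m → (Fin n × Bool) × (Fin n × Bool),
    if Sat2 Φ then formulaProb2 n m p Φ else 0

/-- The probability that a non-uniform random 2-SAT formula is unsatisfiable. -/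
noncomputable def probUnsat2 (n m : ℕ) (p : ℕ → ℝ) : ℝ :=
  ∑ Φ : Fin m → (Fin n × Bool) × (Fin n × Bool),
    if ¬ Sat2 Φ then formulaProb2 n m p Φ else 0

/-- The normalization constant `C = (1 - ∑ pᵢ²)⁻¹`. -/
noncomputable def Cconst (n : ℕ) (p : ℕ → ℝ) : ℝ :=
  (1 - ∑ i ∈ Finset.range n, p i ^ 2)⁻¹

/-- The maximum clause probability `q_max = (C/2)·p₁·p₂`. -/
noncomputable def qmax2 (n : ℕ) (p : ℕ → ℝ) : ℝ :=
  Cconst n p / 2 * p 0 * p 1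

/-- `p n` is a probability vector on `n` variables (indexed `0,…,n-1`), sorted decreasingly,
with all entries positive. -/
def ProbEnsemble (p : ℕ → ℕ → ℝ) : Prop :=
  ∀ n, 1 ≤ n →
    (∑ i ∈ Finset.range n, p n i = 1) ∧
    (∀ i j, i ≤ j → j < n → p n j ≤ p n i) ∧
    (∀ i, i < n → 0 < p n i)

/-- The quantity `(C·p₁·(∑_{i=2}^n pᵢ²)^{1/2})⁻¹`. -/
noncomputable def coarseBound (p : ℕ → ℕ → ℝ) (n : ℕ) : ℝ :=
  (Cconst n (p n) * p n 0 * Real.sqrt (∑ i ∈ Finset.Ico 1 n, p n i ^ 2))⁻¹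

lemma sum_equiv_aux {β γ : Type} {ib : Fintype β} {ic : Fintype γ} (e : β ≃ γ) (f : β → ℝ) (g : γ → ℝ)
    (h : ∀ x, f x = g (e x)) : ∑ x, f x = ∑ x, g x :=
  Fintype.sum_equiv e f g h

/-- Expectation over independent draws. -/
noncomputable def Ew {ι α : Type} [Fintype ι] [Fintype α] (w : α → ℝ) (f : (ι → α) → ℝ) : ℝ :=
  ∑ φ : ι → α, (∏ i, w (φ i)) * f φ

section
variable {ι κ α : Type} [Fintype ι] [Fintype κ] [Fintype α] {w : α → ℝ}

lemma Ew_prod (g : ι → α → ℝ) : Ew w (fun φ : ι → α => ∏ i, g i (φ i)) = ∏ i, ∑ c, w c * g i c := by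
  rw [Finset.prod_univ_sum]
  simp only [Ew, Fintype.piFinset_univ, Finset.prod_mul_distrib]

lemma Ew_one (hw : ∑ c, w c = 1) : Ew w (fun _ : ι → α => 1) = 1 := by
  have := Ew_prod (ι := ι) (w := w) (fun _ _ => 1)
  simpa [hw] using this

lemma Ew_mono (h0 : ∀ c, 0 ≤ w c) {f g : (ι → α) → ℝ} (h : ∀ φ, f φ ≤ g φ) : Ew w f ≤ Ew w g := by
  unfold Ew
  exact Finset.sum_le_sum fun φ _ => mul_le_mul_of_nonneg_left (h φ) (Finset.prod_nonneg fun i _ => h0 _)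

lemma Ew_sum {J : Type} (s : Finset J) (f : J → (ι → α) → ℝ) :
    Ew w (fun φ => ∑ j ∈ s, f j φ) = ∑ j ∈ s, Ew w (f j) := by
  unfold Ew
  rw [Finset.sum_comm]
  simp only [Finset.mul_sum]

lemma Ew_indep (f : (ι → α) → ℝ) (g : (κ → α) → ℝ) :
    Ew w (fun Φ : ι ⊕ κ → α => f (fun i => Φ (Sum.inl i)) * g (fun i => Φ (Sum.inr i)))
      = Ew w f * Ew w g := by
  unfold Ew
  rw [Finset.sum_mul_sum]
  refine Eq.trans ?_ (Fintype.sum_prod_type (fun x : (ι → α) × (κ → α) =>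
    ((∏ i, w (x.1 i)) * f x.1) * ((∏ i, w (x.2 i)) * g x.2)))
  refine sum_equiv_aux (Equiv.sumArrowEquivProdArrow ι κ α) _ _ fun Φ => ?_
  simp [Equiv.sumArrowEquivProdArrow, Function.comp_def]
  ring

lemma Ew_equiv (e : ι ≃ κ) (f : (ι → α) → ℝ) :
    Ew w f = Ew w (fun Φ : κ → α => f (fun i => Φ (e i))) := by
  unfold Ew
  refine (sum_equiv_aux (Equiv.arrowCongr e.symm (Equiv.refl α)) _ _ fun Φ => ?_).symm
  simp only [Equiv.arrowCongr, Equiv.coe_fn_mk, Equiv.symm_symm, Equiv.coe_refl, Function.comp_def, id]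
  rw [Equiv.prod_comp e (fun i => w (Φ i))]

lemma Ew_single (hw : ∑ c, w c = 1) (a : ι) (u : α → ℝ) :
    Ew w (fun φ : ι → α => u (φ a)) = ∑ c, w c * u c := by
  have := Ew_prod (w := w) (fun i c => if i = a then u c else 1)
  rw [Finset.prod_eq_single a] at this
  · simpa using this
  · intro b _ hb; simp [hb, hw]
  · simp

lemma Ew_pair (hw : ∑ c, w c = 1) {a b : ι} (hab : a ≠ b) (u v : α → ℝ) :
    Ew w (fun φ : ι → α => u (φ a) * v (φ b)) = (∑ c, w c * u c) * ∑ c, w c * v c := by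
  have := Ew_prod (w := w) (fun i c => (if i = a then u c else 1) * (if i = b then v c else 1))
  rw [Finset.prod_eq_mul a b hab] at this
  · simp only [Finset.prod_mul_distrib] at this
    simpa [hab, hab.symm] using this
  · intro c _ hc; simp [hc.1, hc.2, hw]
  · simp
  · simp

/-- number of occurrences -/
noncomputable def Nc (c : α) (φ : ι → α) : ℝ := ∑ a, if φ a = c then 1 else 0

lemma Nc_nonneg (c : α) (φ : ι → α) : 0 ≤ Nc c φ :=
  Finset.sum_nonneg fun a _ => by split_ifs <;> norm_num

lemma Ew_Nc (hw : ∑ c, w c = 1) (c : α) : Ew w (Nc (ι := ι) c) = Fintype.card ι * w c := by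
  unfold Nc
  rw [show (fun φ : ι → α => ∑ a, (if φ a = c then (1:ℝ) else 0)) = _ from rfl, Ew_sum]
  simp [Ew_single hw _ (fun x => if x = c then (1:ℝ) else 0)]

lemma Ew_Nc_mul (hw : ∑ c, w c = 1) (h0 : ∀ c, 0 ≤ w c) (c d : α) :
    Ew w (fun φ : ι → α => Nc c φ * Nc d φ) ≤
      (Fintype.card ι : ℝ) ^ 2 * (w c * w d) + if c = d then Fintype.card ι * w c else 0 := by
  have h1 : ∀ a b : ι, Ew w (fun φ : ι → α => (if φ a = c then (1:ℝ) else 0) * (if φ b = d then 1 else 0))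
      ≤ w c * w d + if a = b then (if c = d then w c else 0) else 0 := by
    intro a b
    by_cases hab : a = b
    · subst hab
      rw [Ew_single hw a (fun x => (if x = c then (1:ℝ) else 0) * (if x = d then 1 else 0))]
      have := mul_nonneg (h0 c) (h0 d)
      by_cases hcd : c = d
      · subst hcd; simp; positivity
      · simp [hcd, Ne.symm hcd, this]
    · rw [Ew_pair hw hab (fun x => if x = c then (1:ℝ) else 0) (fun x => if x = d then (1:ℝ) else 0)]
      simp [hab]
  have h2 : Ew w (fun φ : ι → α => Nc c φ * Nc d φ) = ∑ a : ι, ∑ b : ι,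
      Ew w (fun φ : ι → α => (if φ a = c then (1:ℝ) else 0) * (if φ b = d then 1 else 0)) := by
    simp only [Nc, Finset.sum_mul_sum, Ew_sum]
  rw [h2]
  refine (Finset.sum_le_sum fun a _ => Finset.sum_le_sum fun b _ => h1 a b).trans (le_of_eq ?_)
  simp only [Finset.sum_add_distrib, Finset.sum_const, Finset.sum_ite_eq, Finset.mem_univ, if_true,
    Finset.card_univ, nsmul_eq_mul]
  split_ifs <;> ring

lemma second_moment (h0 : ∀ c, 0 ≤ w c) (X : (ι → α) → ℝ) :
    (Ew w X) ^ 2 ≤ Ew w (fun φ => X φ ^ 2) * Ew w (fun φ => if X φ ≠ 0 then 1 else 0) := by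
  unfold Ew
  have hp : ∀ φ : ι → α, 0 ≤ ∏ i, w (φ i) := fun φ => Finset.prod_nonneg fun i _ => h0 _
  apply Finset.sum_sq_le_sum_mul_sum_of_sq_le_mul
  · intro φ _; have := hp φ; positivity
  · intro φ _; have := hp φ; dsimp only; split_ifs <;> simp [this]
  · intro φ _
    by_cases h : X φ = 0
    · simp [h]
    · simp only [ne_eq, h, not_false_eq_true, if_true]
      apply le_of_eq; ring

/-- indicator of a matching pair -/
noncomputable def pairInd {J : Type} {k : ℕ} (c d : J → α) (Φ : Fin k ⊕ Fin k → α) : ℝ :=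
  if ∃ j a b, Φ (Sum.inl a) = c j ∧ Φ (Sum.inr b) = d j then 1 else 0

lemma pair_prob {J : Type} [Fintype J] (hw : ∑ c, w c = 1) (h0 : ∀ c, 0 ≤ w c)
    (c d : J → α) (hc : Function.Injective c) (hd : Function.Injective d)
    (q : J → ℝ) (hcq : ∀ j, w (c j) = q j) (hdq : ∀ j, w (d j) = q j) (k : ℕ)
    (hk : ∀ j, k * q j ≤ 1) (L : ℝ) (hL : 0 < L) (hLq : L ≤ (k:ℝ) ^ 2 * ∑ j, q j ^ 2) :
    L / (L + 3) ≤ Ew w (pairInd (k := k) c d) := by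
  set l := (k:ℝ) ^ 2 * ∑ j, q j ^ 2 with hl
  have hq0 : ∀ j, 0 ≤ q j := fun j => hcq j ▸ h0 _
  let X : (Fin k ⊕ Fin k → α) → ℝ := fun Φ =>
    ∑ j, Nc (c j) (fun i => Φ (Sum.inl i)) * Nc (d j) (fun i => Φ (Sum.inr i))
  have hEX : Ew w X = l := by
    simp only [X, Ew_sum]
    simp only [fun j => Ew_indep (w := w) (Nc (ι := Fin k) (c j)) (Nc (ι := Fin k) (d j)),
      Ew_Nc hw, hcq, hdq, Fintype.card_fin, hl, Finset.mul_sum]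
    exact Finset.sum_congr rfl fun j _ => by ring
  have hEX2 : Ew w (fun Φ => X Φ ^ 2) ≤ l ^ 2 + 3 * l := by
    have e1 : Ew w (fun Φ => X Φ ^ 2) = ∑ j, ∑ i, Ew w (fun φ : Fin k → α => Nc (c j) φ * Nc (c i) φ)
        * Ew w (fun φ : Fin k → α => Nc (d j) φ * Nc (d i) φ) := by
      simp only [X, sq, Finset.sum_mul_sum, Ew_sum]
      refine Finset.sum_congr rfl fun j _ => Finset.sum_congr rfl fun i _ => ?_
      rw [← Ew_indep]
      congr 1; ext Φ; ring
    have e2 : ∀ j i, Ew w (fun φ : Fin k → α => Nc (c j) φ * Nc (c i) φ)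
        * Ew w (fun φ : Fin k → α => Nc (d j) φ * Nc (d i) φ) ≤
        ((k:ℝ)^2 * q j ^ 2) * ((k:ℝ)^2 * q i ^ 2) + if j = i then 3 * ((k:ℝ)^2 * q j ^ 2) else 0 := by
      intro j i
      have a1 := Ew_Nc_mul (ι := Fin k) hw h0 (c j) (c i)
      have a2 := Ew_Nc_mul (ι := Fin k) hw h0 (d j) (d i)
      have a3 : 0 ≤ Ew w (fun φ : Fin k → α => Nc (d j) φ * Nc (d i) φ) :=
        Finset.sum_nonneg fun φ _ => mul_nonneg (Finset.prod_nonneg fun i _ => h0 _)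
          (mul_nonneg (Nc_nonneg _ _) (Nc_nonneg _ _))
      rw [hcq, hcq, hc.eq_iff, Fintype.card_fin] at a1
      rw [hdq, hdq, hd.eq_iff, Fintype.card_fin] at a2
      have hj := hq0 j
      have hi := hq0 i
      refine (mul_le_mul a1 a2 a3 (by split_ifs <;> positivity)).trans ?_
      by_cases hji : j = i
      · subst hji
        simp only [if_true]
        have hx := hk j
        have hx0 : 0 ≤ k * q j := by positivity
        have : (k * q j)^3 ≤ (k * q j)^2 := pow_le_pow_of_le_one hx0 hx (by norm_num)
        nlinarith
      · simp only [hji, if_false]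
        apply le_of_eq; ring
    rw [e1]
    refine (Finset.sum_le_sum fun j _ => Finset.sum_le_sum fun i _ => e2 j i).trans (le_of_eq ?_)
    simp only [Finset.sum_add_distrib, ← Finset.mul_sum, ← Finset.sum_mul, Finset.sum_ite_eq,
      Finset.mem_univ, if_true]
    rw [← hl]; ring
  have hmono : Ew w (fun Φ => if X Φ ≠ 0 then 1 else 0) ≤ Ew w (pairInd (k := k) c d) := by
    apply Ew_mono h0
    intro Φ
    by_cases h : ∃ j a b, Φ (Sum.inl a) = c j ∧ Φ (Sum.inr b) = d j
    · rw [pairInd, if_pos h]; split_ifs <;> norm_num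
    · rw [pairInd, if_neg h, if_neg]
      rw [not_not]
      refine Finset.sum_eq_zero fun j _ => ?_
      simp only [Nc, Finset.sum_mul_sum]
      refine Finset.sum_eq_zero fun a _ => Finset.sum_eq_zero fun b _ => ?_
      by_cases h1 : Φ (Sum.inl a) = c j
      · have h2 : Φ (Sum.inr b) ≠ d j := fun h2 => h ⟨j, a, b, h1, h2⟩
        simp [h2]
      · simp [h1]
  refine le_trans ?_ hmono
  have hs := second_moment h0 X
  rw [hEX] at hs
  set P := Ew w (fun Φ => if X Φ ≠ 0 then 1 else 0)
  have hP : 0 ≤ P := Finset.sum_nonneg fun φ _ => mul_nonneg (Finset.prod_nonneg fun i _ => h0 _)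
    (by dsimp only; split_ifs <;> norm_num)
  have hl0 : 0 < l := lt_of_lt_of_le hL hLq
  have h3 : l ^ 2 ≤ (l ^ 2 + 3 * l) * P := hs.trans (mul_le_mul_of_nonneg_right hEX2 hP)
  have h4 : l ≤ (l + 3) * P := by
    have : l * l ≤ l * ((l + 3) * P) := by nlinarith
    exact le_of_mul_le_mul_left this hl0
  have h5 : l / (l + 3) ≤ P := by rw [div_le_iff₀ (by positivity)]; linarith
  refine le_trans ?_ h5
  rw [div_le_div_iff₀ (by positivity) (by positivity)]
  nlinarith
end

lemma core_unsat (n m k : ℕ) (p : ℕ → ℝ) (hsum : ∑ i ∈ Finset.range (n+1), p i = 1)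
    (hpos : ∀ i, i < n + 1 → 0 < p i) (hC : 0 < 1 - ∑ i ∈ Finset.range (n+1), p i ^ 2)
    (hkm : 4 * k ≤ m)
    (hk : ∀ j, j < n → k * (Cconst (n+1) p / 4 * p 0 * p (j+1)) ≤ 1)
    (L : ℝ) (hL : 0 < L)
    (hLq : L ≤ (k:ℝ)^2 * ∑ i ∈ Finset.Ico 1 (n+1), (Cconst (n+1) p / 4 * p 0 * p i) ^ 2) :
    (L / (L + 3)) ^ 2 ≤ probUnsat2 (n+1) m p := by
  set w := clauseProb2 (n+1) p with hwdef
  have h0 : ∀ c, 0 ≤ w c := by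
    intro c
    simp only [hwdef, clauseProb2]
    have := hpos _ c.1.1.2
    have := hpos _ c.2.1.2
    have := inv_pos.2 hC
    split_ifs <;> positivity
  have hw : ∑ c, w c = 1 := by
    have hs1 : ∑ i : Fin (n+1), p i = 1 := by rw [Fin.sum_univ_eq_sum_range (fun i => p i), hsum]
    have hs2 : ∑ i : Fin (n+1), p i ^ 2 = ∑ i ∈ Finset.range (n+1), p i ^ 2 := by
      rw [Fin.sum_univ_eq_sum_range (fun i => p i ^ 2)]
    have key : ∀ x y : Fin (n+1) , (if x ≠ y then
        (1 - ∑ i ∈ Finset.range (n+1), p i ^ 2)⁻¹ / 4 * p x * p y else 0) =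
        (1 - ∑ i ∈ Finset.range (n+1), p i ^ 2)⁻¹ / 4 * (p x * p y - if x = y then p x ^ 2 else 0) := by
      intro x y
      by_cases h : x = y
      · subst h; simp; right; ring
      · simp [h]; ring
    simp only [hwdef, clauseProb2, Fintype.sum_prod_type, key, Finset.sum_const, Finset.card_univ,
      Fintype.card_bool, ← Finset.mul_sum, Finset.sum_sub_distrib, Finset.sum_ite_eq, Finset.mem_univ,
      if_true, ← Finset.sum_mul, hs1, hs2, nsmul_eq_mul, mul_one]
    field_simp
    norm_num
  let cl : Bool → Bool → Fin n → (Fin (n+1) × Bool) × (Fin (n+1) × Bool) :=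
    fun s t j => ((0, s), (j.succ, t))
  have hinj : ∀ s t, Function.Injective (cl s t) := by
    intro s t i j h
    simpa [cl] using h
  have hwcl : ∀ s t j, w (cl s t j) = Cconst (n+1) p / 4 * p 0 * p (j+1) := by
    intro s t j
    simp [hwdef, cl, clauseProb2, Cconst, (Fin.succ_ne_zero j).symm]
  have hLq' : L ≤ (k:ℝ)^2 * ∑ j : Fin n, (Cconst (n+1) p / 4 * p 0 * p (j+1)) ^ 2 := by
    refine hLq.trans (le_of_eq ?_)
    rw [Finset.sum_Ico_eq_sum_range, ← Fin.sum_univ_eq_sum_range]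
    simp [add_comm]
  have hP : ∀ s, L / (L + 3) ≤ Ew w (pairInd (k := k) (cl s true) (cl s false)) := fun s =>
    pair_prob hw h0 (cl s true) (cl s false) (hinj _ _) (hinj _ _) _ (hwcl _ _) (hwcl _ _) k
      (fun j => hk j j.2) L hL hLq'
  have e : Fin m ≃ ((Fin k ⊕ Fin k) ⊕ (Fin k ⊕ Fin k)) ⊕ Fin (m - 4 * k) := by
    apply Fintype.equivOfCardEq
    simp; omega
  have h1 : probUnsat2 (n+1) m p = Ew w (fun Φ : Fin m → _ => if ¬ Sat2 Φ then 1 else 0) := by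
    unfold probUnsat2 Ew
    refine sum_equiv_aux (Equiv.refl _) _ _ fun Φ => ?_
    by_cases h : Sat2 Φ <;> simp [h, formulaProb2, hwdef]
  let A : Bool → (Fin k ⊕ Fin k → (Fin (n+1) × Bool) × (Fin (n+1) × Bool)) → ℝ := fun s =>
    pairInd (cl s true) (cl s false)
  have h2 : Ew w (A true) * Ew w (A false) ≤ probUnsat2 (n+1) m p := by
    have h3 := Ew_indep (κ := Fin (m - 4*k)) (w := w) (fun Φ : (Fin k ⊕ Fin k) ⊕ (Fin k ⊕ Fin k) → _ =>
      A true (fun i => Φ (Sum.inl i)) * A false (fun i => Φ (Sum.inr i))) (fun _ => 1)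
    rw [Ew_indep, Ew_one hw, mul_one] at h3
    rw [h1, Ew_equiv e, ← h3]
    apply Ew_mono h0
    intro Φ
    simp only [A, mul_one, pairInd]
    by_cases hT : ∃ j a b, Φ (Sum.inl (Sum.inl (Sum.inl a))) = cl true true j ∧
      Φ (Sum.inl (Sum.inl (Sum.inr b))) = cl true false j
    swap
    · rw [if_neg hT, zero_mul]; split_ifs <;> simp
    by_cases hF : ∃ j a b, Φ (Sum.inl (Sum.inr (Sum.inl a))) = cl false true j ∧
      Φ (Sum.inl (Sum.inr (Sum.inr b))) = cl false false j
    swap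
    · rw [if_neg hF, mul_zero]; split_ifs <;> simp
    rw [if_pos hT, if_pos hF, if_pos, mul_one]
    rintro ⟨a, ha⟩
    obtain ⟨j, x, y, hx, hy⟩ := hT
    obtain ⟨i, u, v, hu, hv⟩ := hF
    have b1 := ha (e.symm (Sum.inl (Sum.inl (Sum.inl x))))
    have b2 := ha (e.symm (Sum.inl (Sum.inl (Sum.inr y))))
    have b3 := ha (e.symm (Sum.inl (Sum.inr (Sum.inl u))))
    have b4 := ha (e.symm (Sum.inl (Sum.inr (Sum.inr v))))
    simp only [Equiv.apply_symm_apply, hx, hy, hu, hv, cl] at b1 b2 b3 b4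
    cases h0 : a 0 <;> simp_all
  refine le_trans ?_ h2
  rw [sq]
  have : 0 ≤ L / (L + 3) := by positivity
  exact mul_le_mul (hP true) (hP false) this (this.trans (hP true))

set_option maxHeartbeats 1000000 in
/-- Main theorem. -/
theorem nonuniform_2SAT_unsat_at_coarse_threshold
    (p : ℕ → ℕ → ℝ) (hp : ProbEnsemble p)
    (hΘ : (fun n => p n 0 ^ 2) =Θ[atTop] fun n => ∑ i ∈ Finset.range n, p n i ^ 2)
    (ho : (fun n => p n 1 ^ 2) =o[atTop] fun n => ∑ i ∈ Finset.Ico 1 n, p n i ^ 2)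
    (m : ℕ → ℕ)
    (hm : (fun n => (m n : ℝ)) =Θ[atTop] fun n => coarseBound p n) :
    ∃ δ : ℝ, 0 < δ ∧ ∀ᶠ n in atTop, δ ≤ probUnsat2 n (m n) (p n) := by
  obtain ⟨c2, hc2, hup⟩ := hm.1.exists_pos
  obtain ⟨c1, hc1, hlo⟩ := hm.2.exists_pos
  -- `m ≤ c2 * coarse`, `coarse ≤ c1 * m`
  set ε : ℝ := min (1 / c2) (1 / (4 * c1)) with hε
  have hε0 : 0 < ε := by positivity
  set L : ℝ := (1 / (32 * c1)) ^ 2 with hLdef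
  have hL : 0 < L := by positivity
  refine ⟨(L / (L + 3)) ^ 2, by positivity, ?_⟩
  have ho' := ho.bound (c := ε ^ 2) (by positivity)
  filter_upwards [hup.bound, hlo.bound, ho', eventually_ge_atTop 2] with N h1 h2 h3 hN
  obtain ⟨n, rfl⟩ : ∃ n, N = n + 1 := ⟨N - 1, by omega⟩
  obtain ⟨hsum, hanti, hpos⟩ := hp (n+1) (by omega)
  simp only [coarseBound] at h1 h2
  set P := p (n+1) with hPdef
  set S := ∑ i ∈ Finset.Ico 1 (n+1), P i ^ 2 with hS
  have hp0 := hpos 0 (by omega)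
  have hp1 := hpos 1 (by omega)
  have hSpos : 0 < S := by
    apply Finset.sum_pos
    · intro i hi; have := hpos i (by simp at hi; omega); positivity
    · exact ⟨1, by simp; omega⟩
  have hrest : ∑ i ∈ Finset.Ico 1 (n+1), P i = 1 - P 0 := by
    rw [← hsum, Finset.range_eq_Ico, Finset.sum_eq_sum_Ico_succ_bot (by omega : 0 < n + 1)]
    simp
  have hp0lt : P 0 < 1 := by
    have : 0 < ∑ i ∈ Finset.Ico 1 (n+1), P i := by
      apply Finset.sum_pos
      · intro i hi; exact hpos i (by simp at hi; omega)
      · exact ⟨1, by simp; omega⟩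
    linarith
  have hSle : S ≤ P 1 * (1 - P 0) := by
    rw [← hrest, Finset.mul_sum]
    apply Finset.sum_le_sum
    intro i hi
    simp only [Finset.mem_Ico] at hi
    have := hpos i (by omega)
    rw [sq]
    exact mul_le_mul_of_nonneg_right (hanti 1 i hi.1 hi.2) this.le
  have hsq : 1 - P 0 ≤ 1 - ∑ i ∈ Finset.range (n+1), P i ^ 2 := by
    have : ∑ i ∈ Finset.range (n+1), P i ^ 2 ≤ P 0 * 1 := by
      rw [← hsum, Finset.mul_sum]
      apply Finset.sum_le_sum
      intro i hi
      simp only [Finset.mem_range] at hi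
      have := hpos i (by omega)
      rw [sq]
      exact mul_le_mul_of_nonneg_right (hanti 0 i (by omega) hi) this.le
    linarith
  have hC : 0 < 1 - ∑ i ∈ Finset.range (n+1), P i ^ 2 := by linarith
  set C := Cconst (n+1) P with hCdef
  have hC0 : 0 < C := inv_pos.2 hC
  have hC1 : C * (1 - P 0) ≤ 1 := by
    calc C * (1 - P 0) ≤ C * (1 - ∑ i ∈ Finset.range (n+1), P i ^ 2) :=
          mul_le_mul_of_nonneg_left hsq hC0.le
      _ = 1 := inv_mul_cancel₀ hC.ne'
  set R := Real.sqrt S with hR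
  have hR0 : 0 < R := Real.sqrt_pos.2 hSpos
  have hRS : R ^ 2 = S := Real.sq_sqrt hSpos.le
  have h3' : P 1 ≤ ε * R := by
    rw [Real.norm_of_nonneg (by positivity), Real.norm_of_nonneg hSpos.le, ← hRS, ← mul_pow] at h3
    exact le_of_sq_le_sq h3 (by positivity)
  have hRle : R ≤ ε * (1 - P 0) := by
    have : R * R ≤ R * (ε * (1 - P 0)) := by
      have := mul_le_mul_of_nonneg_right h3' (by linarith : (0:ℝ) ≤ 1 - P 0)
      nlinarith
    exact le_of_mul_le_mul_left this hR0
  set D := C * P 0 * R with hD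
  have hD0 : 0 < D := by positivity
  have hDle : D ≤ ε := by
    have a : C * R ≤ ε := by
      have := mul_le_mul_of_nonneg_left hRle hC0.le
      nlinarith
    have : C * R * P 0 ≤ C * R * 1 := mul_le_mul_of_nonneg_left hp0lt.le (by positivity)
    rw [hD]; nlinarith
  rw [Real.norm_of_nonneg (by positivity), Real.norm_of_nonneg (by positivity)] at h1 h2
  have h1' : (m (n+1) : ℝ) * D ≤ c2 := by
    rwa [← div_eq_mul_inv, le_div_iff₀ hD0] at h1
  have h2' : 1 ≤ c1 * m (n+1) * D := by
    rwa [inv_le_iff_one_le_mul₀ hD0] at h2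
  have hεc1 : ε * (4 * c1) ≤ 1 := by
    have := min_le_right (1 / c2) (1 / (4 * c1))
    rwa [← hε, le_div_iff₀ (by positivity)] at this
  have hεc2 : ε * c2 ≤ 1 := by
    have := min_le_left (1 / c2) (1 / (4 * c1))
    rwa [← hε, le_div_iff₀ (by positivity)] at this
  have hm4 : 4 ≤ m (n+1) := by
    have : (4:ℝ) ≤ m (n+1) := by
      by_contra hlt
      push Not at hlt
      have a : c1 * m (n+1) * D ≤ c1 * m (n+1) * ε := mul_le_mul_of_nonneg_left hDle (by positivity)
      have b : m (n+1) * (c1 * ε) < 4 * (c1 * ε) := mul_lt_mul_of_pos_right hlt (by positivity)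
      nlinarith
    exact_mod_cast this
  set k := m (n+1) / 4 with hk
  have hk8 : (m (n+1) : ℝ) ≤ 8 * k := by
    have : m (n+1) ≤ 8 * k := by omega
    exact_mod_cast this
  have hk4 : 4 * (k:ℝ) ≤ m (n+1) := by
    have : 4 * k ≤ m (n+1) := by omega
    exact_mod_cast this
  apply core_unsat n (m (n+1)) k P hsum hpos hC (by omega) _ L hL
  · rw [← hCdef]
    have : ∑ i ∈ Finset.Ico 1 (n+1), (C / 4 * P 0 * P i) ^ 2 = (D / 4) ^ 2 := by
      simp only [mul_pow _ (P _)]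
      rw [← Finset.mul_sum, ← hS, ← hRS, hD]; ring
    rw [this, hLdef, ← mul_pow]
    apply pow_le_pow_left₀ (by positivity)
    rw [div_le_iff₀ (by positivity)]
    have h8 := mul_le_mul_of_nonneg_left hk8 (by positivity : 0 ≤ c1 * D)
    calc (1:ℝ) ≤ c1 * m (n+1) * D := h2'
      _ = c1 * D * m (n+1) := by ring
      _ ≤ c1 * D * (8 * k) := h8
      _ = k * (D / 4) * (32 * c1) := by ring
  · intro j hj
    rw [← hCdef]
    have hPj : P (j+1) ≤ ε * R := (hanti 1 (j+1) (by omega) (by omega)).trans h3'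
    have a : k * (C / 4 * P 0 * P (j+1)) ≤ k * (C / 4 * P 0 * (ε * R)) := by gcongr
    have b : k * (C / 4 * P 0 * (ε * R)) = (k * D) * ε / 4 := by rw [hD]; ring
    have c : k * D ≤ c2 := by
      have h00 : (0:ℝ) ≤ k := Nat.cast_nonneg k
      have hkm : (k:ℝ) ≤ m (n+1) := by linarith only [h00, hk4]
      exact (mul_le_mul_of_nonneg_right hkm hD0.le).trans h1'
    have d : k * D * ε ≤ c2 * ε := by gcongr
    rw [b] at a
    linarith only [a, d, hεc2]
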